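/- Let A, B ∈ ℂ^{n₁×n₁×n₃} with A ⋆ B = B ⋆ A, let k = max{ind(A), ind(B)}, and let A^{GD}, B^{GD} be GD inverses of A and B satisfying the GD equations with exponent k. If A ⋆ A^{GD} ⋆ B^{GD} = B^{GD} and B^{GD} ⋆ B ⋆ A ⋆ A* = A ⋆ A* ⋆ B^{GD} ⋆ B, then A^{GD} ⋆ B^{GD} is a GD inverse of A ⋆ B with exponent k and the corresponding GD-Star inverse satisfies (A⋆B)^{GD,*} = A^{GD,*} ⋆ B^{GD,*}, i.e., (A^{GD}⋆B^{GD}) ⋆ (A⋆B) ⋆ (A⋆B)* = (A^{GD}⋆A⋆A*) ⋆ (B^{GD}⋆B⋆B*). -/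

import Mathlib

open Matrix BigOperators

/-- A third-order complex tensor in `ℂ^{n₁ × n₂ × n₃}`, given by its frontal slices. -/
abbrev Tensor3 (n₁ n₂ n₃ : ℕ) := Fin n₃ → Matrix (Fin n₁) (Fin n₂) ℂ

/-- Mode-3 product of a tensor with an `n₃ × n₃` matrix: the slices of the result are the
indicated linear combinations of the slices of `A`. -/
noncomputable def mode3 {n₁ n₂ n₃ : ℕ} (M : Matrix (Fin n₃) (Fin n₃) ℂ) (A : Tensor3 n₁ n₂ n₃) :
    Tensor3 n₁ n₂ n₃ :=
  fun i => ∑ j, M i j • A j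

/-- The M-product `A ⋆_M B`: slice-wise matrix product in the transformed (hat) domain,
transformed back by `M⁻¹`. -/
noncomputable def mprod {n₁ n₂ l n₃ : ℕ} (M : Matrix (Fin n₃) (Fin n₃) ℂ)
    (A : Tensor3 n₁ n₂ n₃) (B : Tensor3 n₂ l n₃) : Tensor3 n₁ l n₃ :=
  mode3 M⁻¹ (fun i => mode3 M A i * mode3 M B i)

/-- The identity tensor: every slice of its mode-3 transform is the identity matrix. -/
noncomputable def idT (n₁ : ℕ) {n₃ : ℕ} (M : Matrix (Fin n₃) (Fin n₃) ℂ) : Tensor3 n₁ n₁ n₃ :=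
  mode3 M⁻¹ (fun _ => (1 : Matrix (Fin n₁) (Fin n₁) ℂ))

/-- Powers of a square tensor with respect to the M-product. -/
noncomputable def mpow {n₁ n₃ : ℕ} (M : Matrix (Fin n₃) (Fin n₃) ℂ) (A : Tensor3 n₁ n₁ n₃) :
    ℕ → Tensor3 n₁ n₁ n₃
  | 0 => idT n₁ M
  | k + 1 => mprod M (mpow M A k) A

/-- Conjugate transpose with respect to the M-product: slice-wise conjugate transpose in the
transformed domain. -/
noncomputable def ctrans {n₁ n₂ n₃ : ℕ} (M : Matrix (Fin n₃) (Fin n₃) ℂ) (A : Tensor3 n₁ n₂ n₃) :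
    Tensor3 n₂ n₁ n₃ :=
  mode3 M⁻¹ (fun i => (mode3 M A i)ᴴ)

/-- Index of a square complex matrix: the least `k ≥ 0` with `rank(B^k) = rank(B^{k+1})`. -/
noncomputable def matIndex {n : ℕ} (B : Matrix (Fin n) (Fin n) ℂ) : ℕ :=
  sInf {k : ℕ | (B ^ k).rank = (B ^ (k + 1)).rank}

/-- Index of a tensor: the maximum of the indices of the slices of its mode-3 transform. -/
noncomputable def tIndex {n₁ n₃ : ℕ} (M : Matrix (Fin n₃) (Fin n₃) ℂ)
    (A : Tensor3 n₁ n₁ n₃) : ℕ :=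
  Finset.univ.sup fun i => matIndex (mode3 M A i)

/-- `X` is a GD inverse of `A` with exponent `k`:
`A ⋆ X ⋆ A = A`, `X ⋆ A^{k+1} = A^k`, `A^{k+1} ⋆ X = A^k`. -/
def IsGD {n₁ n₃ : ℕ} (M : Matrix (Fin n₃) (Fin n₃) ℂ) (A X : Tensor3 n₁ n₁ n₃)
    (k : ℕ) : Prop :=
  mprod M (mprod M A X) A = A ∧
  mprod M X (mpow M A (k + 1)) = mpow M A k ∧
  mprod M (mpow M A (k + 1)) X = mpow M A k

/-- `X` is the Drazin inverse of `A` with exponent `k`. -/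
def IsDrazin {n₁ n₃ : ℕ} (M : Matrix (Fin n₃) (Fin n₃) ℂ) (A X : Tensor3 n₁ n₁ n₃)
    (k : ℕ) : Prop :=
  mprod M X (mpow M A (k + 1)) = mpow M A k ∧
  mprod M (mprod M X A) X = X ∧
  mprod M X A = mprod M A X

/-- `X` is the Moore–Penrose inverse of `A`. -/
def IsMP {n₁ n₃ : ℕ} (M : Matrix (Fin n₃) (Fin n₃) ℂ) (A X : Tensor3 n₁ n₁ n₃) : Prop :=
  mprod M (mprod M A X) A = A ∧
  mprod M (mprod M X A) X = X ∧
  ctrans M (mprod M A X) = mprod M A X ∧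
  ctrans M (mprod M X A) = mprod M X A

theorem mode3_mode3 {n₁ n₂ n₃ : ℕ} (M N : Matrix (Fin n₃) (Fin n₃) ℂ) (A : Tensor3 n₁ n₂ n₃) :
    mode3 M (mode3 N A) = mode3 (M * N) A := by
  funext i
  simp only [mode3, Matrix.mul_apply, Finset.smul_sum, Finset.sum_smul, smul_smul]
  exact Finset.sum_comm

theorem mode3_one {n₁ n₂ n₃ : ℕ} (A : Tensor3 n₁ n₂ n₃) : mode3 1 A = A := by
  funext i
  simp [mode3, Matrix.one_apply]

section Transform

variable {n₁ n₂ n₃ : ℕ} {M : Matrix (Fin n₃) (Fin n₃) ℂ}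

theorem mode3_mode3_inv (hM : IsUnit M) (A : Tensor3 n₁ n₂ n₃) :
    mode3 M (mode3 M⁻¹ A) = A := by
  rw [mode3_mode3, Matrix.mul_nonsing_inv _ ((Matrix.isUnit_iff_isUnit_det M).1 hM), mode3_one]

theorem mode3_injective (hM : IsUnit M) :
    Function.Injective (mode3 M : Tensor3 n₁ n₂ n₃ → Tensor3 n₁ n₂ n₃) := by
  refine Function.LeftInverse.injective (g := mode3 M⁻¹) fun A => ?_
  rw [mode3_mode3, Matrix.nonsing_inv_mul _ ((Matrix.isUnit_iff_isUnit_det M).1 hM), mode3_one]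

theorem mode3_mprod (hM : IsUnit M) (A B : Tensor3 n₁ n₁ n₃) :
    mode3 M (mprod M A B) = mode3 M A * mode3 M B :=
  mode3_mode3_inv hM _

theorem mode3_mpow (hM : IsUnit M) (A : Tensor3 n₁ n₁ n₃) (k : ℕ) :
    mode3 M (mpow M A k) = mode3 M A ^ k := by
  induction k with
  | zero => exact mode3_mode3_inv hM _
  | succ k ih => rw [mpow, mode3_mprod hM, ih, pow_succ]

theorem mode3_ctrans (hM : IsUnit M) (A : Tensor3 n₁ n₁ n₃) :
    mode3 M (ctrans M A) = star (mode3 M A) :=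
  mode3_mode3_inv hM _

theorem isGD_iff (hM : IsUnit M) (A X : Tensor3 n₁ n₁ n₃) (k : ℕ) :
    IsGD M A X k ↔
      mode3 M A * mode3 M X * mode3 M A = mode3 M A ∧
      mode3 M X * mode3 M A ^ (k + 1) = mode3 M A ^ k ∧
      mode3 M A ^ (k + 1) * mode3 M X = mode3 M A ^ k := by
  unfold IsGD
  rw [← (mode3_injective hM).eq_iff, ← (mode3_injective hM).eq_iff (b := mpow M A k),
    ← (mode3_injective hM).eq_iff (b := mpow M A k)]
  simp only [mode3_mprod hM, mode3_mpow hM]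

end Transform

theorem gd_mul_of_commute {R : Type*} [Monoid R] {a b x y : R} {k : ℕ} (hab : Commute a b)
    (hx : x * a ^ (k + 1) = a ^ k) (hx' : a ^ (k + 1) * x = a ^ k)
    (hb : b * y * b = b) (hy : y * b ^ (k + 1) = b ^ k) (hy' : b ^ (k + 1) * y = b ^ k)
    (h : a * x * y = y) :
    a * b * (x * y) * (a * b) = a * b ∧
    x * y * (a * b) ^ (k + 1) = (a * b) ^ k ∧
    (a * b) ^ (k + 1) * (x * y) = (a * b) ^ k := by
  refine ⟨?_, ?_, ?_⟩
  · calc a * b * (x * y) * (a * b) = b * (a * x * y) * (b * a) := by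
          rw [hab.eq]; simp only [mul_assoc]
      _ = b * y * b * a := by rw [h]; simp only [mul_assoc]
      _ = a * b := by rw [hb, hab.eq]
  · calc x * y * (a * b) ^ (k + 1) = x * (y * b ^ (k + 1)) * a ^ (k + 1) := by
          rw [hab.eq, hab.symm.mul_pow]; simp only [mul_assoc]
      _ = x * a ^ (k + 1) * b ^ k := by
          rw [hy, mul_assoc, ← (hab.pow_pow (k + 1) k).eq, mul_assoc]
      _ = (a * b) ^ k := by rw [hx, hab.mul_pow]
  · calc (a * b) ^ (k + 1) * (x * y) = b ^ (k + 1) * (a ^ (k + 1) * x) * y := by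
          rw [hab.eq, hab.symm.mul_pow]; simp only [mul_assoc]
      _ = a ^ k * (b ^ (k + 1) * y) := by
          rw [hx', ← (hab.pow_pow k (k + 1)).eq, mul_assoc]
      _ = (a * b) ^ k := by rw [hy', hab.mul_pow]

theorem gdStar_mul_of_commute {R : Type*} [Monoid R] [StarMul R] {a b x y : R}
    (hab : Commute a b) (h : y * b * a * star a = a * star a * y * b) :
    x * y * (a * b) * star (a * b) = x * a * star a * (y * b * star b) := by
  calc x * y * (a * b) * star (a * b) = x * (y * b * a * star a) * star b := by
        rw [hab.eq, star_mul]; simp only [mul_assoc]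
    _ = x * a * star a * (y * b * star b) := by rw [h]; simp only [mul_assoc]

/-- forward order law for the GD-Star inverse. -/
theorem gdstar_forward_order_law {n₁ n₃ : ℕ} (hn₁ : 0 < n₁) (hn₃ : 0 < n₃)
    (M : Matrix (Fin n₃) (Fin n₃) ℂ) (hM : IsUnit M)
    (A B AGD BGD : Tensor3 n₁ n₁ n₃) (k : ℕ)
    (hcomm : mprod M A B = mprod M B A)
    (hk : k = max (tIndex M A) (tIndex M B))
    (hAGD : IsGD M A AGD k) (hBGD : IsGD M B BGD k)
    (h1 : mprod M (mprod M A AGD) BGD = BGD)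
    (h2 : mprod M (mprod M (mprod M BGD B) A) (ctrans M A) =
      mprod M (mprod M (mprod M A (ctrans M A)) BGD) B) :
    IsGD M (mprod M A B) (mprod M AGD BGD) k ∧
    mprod M (mprod M (mprod M AGD BGD) (mprod M A B)) (ctrans M (mprod M A B)) =
      mprod M (mprod M (mprod M AGD A) (ctrans M A)) (mprod M (mprod M BGD B) (ctrans M B)) := by
  rw [isGD_iff hM] at hAGD hBGD
  obtain ⟨-, hA₁, hA₂⟩ := hAGD
  obtain ⟨hB₀, hB₁, hB₂⟩ := hBGD
  rw [← (mode3_injective hM).eq_iff] at hcomm h1 h2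
  simp only [mode3_mprod hM, mode3_ctrans hM] at hcomm h1 h2
  refine ⟨?_, mode3_injective hM ?_⟩
  · simpa only [isGD_iff hM, mode3_mprod hM] using
      gd_mul_of_commute hcomm hA₁ hA₂ hB₀ hB₁ hB₂ h1
  · simpa only [mode3_mprod hM, mode3_ctrans hM] using gdStar_mul_of_commute hcomm h2
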